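/- Let α be irrational and N ≥ 2, with first(N) and last(N) defined as the minimizer and maximizer of {m·α} over 0 < m < N. If {first(N)·α} + {last(N)·α} ≥ 1, then {(first(N) + last(N))·α} < {first(N)·α}. -/

import Mathlib

theorem fract_first_add_last_lt (α : ℝ) (hα : Irrational α) (N : ℕ) (hN : 2 ≤ N)
    (f l : ℕ) (hf0 : 0 < f) (hfN : f < N)
    (hf : ∀ m : ℕ, 0 < m → m < N → Int.fract (f * α) ≤ Int.fract (m * α))
    (hl0 : 0 < l) (hlN : l < N)
    (hl : ∀ m : ℕ, 0 < m → m < N → Int.fract (m * α) ≤ Int.fract (l * α))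
    (h : Int.fract (f * α) + Int.fract (l * α) ≥ 1) :
    Int.fract ((f + l : ℕ) * α) < Int.fract (f * α) := by
  have hl1 := Int.fract_lt_one ((l : ℝ) * α)
  have hf1 := Int.fract_lt_one ((f : ℝ) * α)
  have key : Int.fract (((f + l : ℕ) : ℝ) * α) =
      Int.fract ((f : ℝ) * α) + Int.fract ((l : ℝ) * α) - 1 := by
    rw [Int.fract_eq_iff]
    refine ⟨by linarith, by linarith, ⌊(f : ℝ) * α⌋ + ⌊(l : ℝ) * α⌋ + 1, ?_⟩
    have h1 := Int.floor_add_fract ((f : ℝ) * α)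
    have h2 := Int.floor_add_fract ((l : ℝ) * α)
    push_cast
    linarith
  rw [key]
  linarith
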